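/- arXiv:q-alg/9707009 — 3 statements merged into one kernel-verified Lean document; each statement's English description precedes it below -/
import Mathlib

section
/- Let S be an associative ring and Ť a group isomorphic to ℤ^l acting on S by ring automorphisms, and let Š = S#Ť be the skew product. If I is a Ť-invariant prime two-sided ideal of S, then J := I#Ť, the set of all elements of Š whose coefficients all lie in I (i.e., the additive span of {s ⊗ t : s ∈ I, t ∈ Ť}), is a prime two-sided ideal of Š, and J ∩ S = I, where S is identified with S ⊗ 1 inside Š. -/
/-- Let `S` be an associative ring and `T` a group isomorphic to `ℤ^l`
acting on `S` by ring automorphisms (right action `act s t = s.t`).  Let `Sk = S#T` be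
the skew product: there is a ring embedding `j : S →+* Sk` and a group homomorphism
`u : T →* Skˣ` with `(u t) * j s = j (s.t⁻¹) * (u t)`, such that `Sk` is free as a left
`S`-module with basis `{u t : t ∈ T}` (every element is uniquely a finite sum
`Σ j(s_t) * u t`).  If `I` is a `T`-invariant prime two-sided ideal of `S`, then
`J := I#T` (the set of elements all of whose coefficients lie in `I`) is a prime
two-sided ideal of `Sk`, and `J ∩ S = I` (identifying `S` with `j(S) = S ⊗ 1`). -/
theorem skew_product_of_invariant_prime_is_prime
    {S T Sk : Type*} [Ring S] [Group T] [Ring Sk]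
    (l : ℕ) (e : T ≃* Multiplicative (Fin l → ℤ))
    (act : S → T → S)
    (hact_add : ∀ t s₁ s₂, act (s₁ + s₂) t = act s₁ t + act s₂ t)
    (hact_mul : ∀ t s₁ s₂, act (s₁ * s₂) t = act s₁ t * act s₂ t)
    (hact_one : ∀ t, act 1 t = 1)
    (hact_id : ∀ s, act s 1 = s)
    (hact_comp : ∀ s t₁ t₂, act (act s t₁) t₂ = act s (t₁ * t₂))
    (j : S →+* Sk) (u : T →* Skˣ)
    (hcomm : ∀ t s, (u t : Sk) * j s = j (act s t⁻¹) * (u t : Sk))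
    (hfree : Function.Bijective fun f : T →₀ S => f.sum fun t s => j s * (u t : Sk))
    (I : TwoSidedIdeal S)
    (hInv : ∀ t, ∀ s ∈ I, act s t ∈ I)
    (hIproper : (I : Set S) ≠ Set.univ)
    (hIprime : ∀ a b : S, (∀ c : S, a * c * b ∈ I) → a ∈ I ∨ b ∈ I) :
    let J : Set Sk := {x | ∃ f : T →₀ S, (∀ t, f t ∈ I) ∧
      x = f.sum fun t s => j s * (u t : Sk)}
    ((0 : Sk) ∈ J) ∧
    (∀ x ∈ J, ∀ y ∈ J, x + y ∈ J) ∧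
    (∀ x ∈ J, -x ∈ J) ∧
    (∀ r : Sk, ∀ x ∈ J, r * x ∈ J ∧ x * r ∈ J) ∧
    J ≠ Set.univ ∧
    (∀ a b : Sk, (∀ c : Sk, a * c * b ∈ J) → a ∈ J ∨ b ∈ J) ∧
    (∀ s : S, j s ∈ J ↔ s ∈ I) := by
  classical
  intro J
  let φ : (T →₀ S) →+ Sk := Finsupp.liftAddHom fun t =>
    (AddMonoidHom.mulRight (u t : Sk)).comp j.toAddMonoidHom
  have hφ : ∀ f : T →₀ S, φ f = f.sum fun t s => j s * (u t : Sk) := fun f => rfl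
  have hφs : ∀ t s, φ (Finsupp.single t s) = j s * (u t : Sk) := by
    intro t s
    rw [hφ, Finsupp.sum_single_index]
    simp
  have hinj : Function.Injective φ := hfree.1
  have hsurj : Function.Surjective φ := hfree.2
  have hJ : ∀ f : T →₀ S, φ f ∈ J ↔ ∀ t, f t ∈ I := by
    intro f
    constructor
    · rintro ⟨g, hg, h⟩
      have : f = g := hinj h
      rw [this]; exact hg
    · intro h
      exact ⟨f, h, rfl⟩
  have hprod : ∀ (f g : T →₀ S) (c : S), φ f * j c * φ g =
      φ (∑ t ∈ f.support, ∑ s ∈ g.support,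
        Finsupp.single (t * s) (f t * act c t⁻¹ * act (g s) t⁻¹)) := by
    intro f g c
    simp only [map_sum, hφs]
    rw [hφ f, hφ g, Finsupp.sum, Finsupp.sum, Finset.sum_mul, Finset.sum_mul_sum]
    refine Finset.sum_congr rfl fun t _ => Finset.sum_congr rfl fun s _ => ?_
    have h1 := hcomm t (c * g s)
    rw [hact_mul, map_mul, map_mul] at h1
    simp only [map_mul, Units.val_mul]
    calc j (f t) * (u t : Sk) * j c * (j (g s) * (u s : Sk))
        = j (f t) * ((u t : Sk) * (j c * j (g s))) * (u s : Sk) := by noncomm_ring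
      _ = _ := by rw [h1]; noncomm_ring
  have hcoef : ∀ (f g : T →₀ S) (c : S) (x : T),
      (∑ t ∈ f.support, ∑ s ∈ g.support,
        Finsupp.single (t * s) (f t * act c t⁻¹ * act (g s) t⁻¹)) x =
      ∑ t ∈ f.support, ∑ s ∈ g.support,
        if t * s = x then f t * act c t⁻¹ * act (g s) t⁻¹ else 0 := by
    intro f g c x
    simp only [Finsupp.finsetSum_apply, Finsupp.single_apply]
  have hsumI : ∀ {s : Finset T} {F : T → S}, (∀ t ∈ s, F t ∈ I) → ∑ t ∈ s, F t ∈ I := by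
    intro s F h
    exact sum_mem h
  have hmulJ : ∀ f g : T →₀ S, ((∀ t, f t ∈ I) ∨ ∀ t, g t ∈ I) → φ f * φ g ∈ J := by
    intro f g h
    have h1 := hprod f g 1
    rw [map_one, mul_one] at h1
    rw [h1, hJ]
    intro x
    rw [hcoef]
    refine hsumI fun t _ => hsumI fun s _ => ?_
    split_ifs
    · rcases h with h | h
      · exact I.mul_mem_right _ _ (I.mul_mem_right _ _ (h t))
      · exact I.mul_mem_left _ _ (hInv _ _ (h s))
    · exact I.zero_mem
  have hjs : ∀ s : S, j s ∈ J ↔ s ∈ I := by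
    intro s
    have : j s = φ (Finsupp.single 1 s) := by rw [hφs]; simp
    rw [this, hJ]
    constructor
    · intro h; simpa using h 1
    · intro h t
      rw [Finsupp.single_apply]
      split_ifs
      · exact h
      · exact I.zero_mem
  refine ⟨?_, ?_, ?_, ?_, ?_, ?_, hjs⟩
  · rw [← map_zero φ, hJ]
    intro t; exact I.zero_mem
  · rintro x ⟨f, hf, rfl⟩ y ⟨g, hg, rfl⟩
    rw [← hφ, ← hφ, ← map_add, hJ]
    intro t; exact I.add_mem (hf t) (hg t)
  · rintro x ⟨f, hf, rfl⟩
    rw [← hφ, ← map_neg, hJ]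
    intro t; exact I.neg_mem (hf t)
  · rintro r x ⟨f, hf, rfl⟩
    obtain ⟨g, rfl⟩ := hsurj r
    exact ⟨hmulJ g f (Or.inr hf), hmulJ f g (Or.inl hf)⟩
  · intro h
    apply hIproper
    ext s
    simpa using (hjs s).1 (h ▸ Set.mem_univ _)
  · intro a b hab
    obtain ⟨f, rfl⟩ := hsurj a
    obtain ⟨g, rfl⟩ := hsurj b
    rw [hJ, hJ]
    by_contra! hcon
    obtain ⟨⟨t₁, ht₁⟩, ⟨s₁, hs₁⟩⟩ := hcon
    have hsupp : ∀ (f : T →₀ S) t, f t ∉ I → t ∈ f.support := by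
      intro f t h
      rw [Finsupp.mem_support_iff]
      intro h0
      exact h (h0 ▸ I.zero_mem)
    haveI : UniqueProds T := e.uniqueProds_iff.2 inferInstance
    obtain ⟨t₀, ht₀, s₀, hs₀, huniq⟩ := UniqueProds.uniqueMul_of_nonempty
      (A := f.support.filter fun t => f t ∉ I) (B := g.support.filter fun t => g t ∉ I)
      ⟨t₁, Finset.mem_filter.2 ⟨hsupp f _ ht₁, ht₁⟩⟩
      ⟨s₁, Finset.mem_filter.2 ⟨hsupp g _ hs₁, hs₁⟩⟩
    rw [Finset.mem_filter] at ht₀ hs₀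
    have key : ∀ c, f t₀ * act c t₀⁻¹ * act (g s₀) t₀⁻¹ ∈ I := by
      intro c
      have h := hab (j c)
      rw [hprod, hJ] at h
      have h := h (t₀ * s₀)
      rw [hcoef, ← Finset.sum_product',
        ← Finset.add_sum_erase _ _ (Finset.mk_mem_product ht₀.1 hs₀.1)] at h
      simp only [if_true] at h
      refine (add_mem_cancel_right ?_).1 h
      refine sum_mem ?_
      rintro ⟨t, s⟩ hts
      rw [Finset.mem_erase, Finset.mem_product] at hts
      obtain ⟨hne, ht, hs⟩ := hts
      dsimp only at ht hs ⊢
      split_ifs with heq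
      · by_cases hft : f t ∈ I
        · exact I.mul_mem_right _ _ (I.mul_mem_right _ _ hft)
        · by_cases hgs : g s ∈ I
          · exact I.mul_mem_left _ _ (hInv _ _ hgs)
          · obtain ⟨h1, h2⟩ := huniq (Finset.mem_filter.2 ⟨ht, hft⟩)
              (Finset.mem_filter.2 ⟨hs, hgs⟩) heq
            exact absurd (by rw [h1, h2]) hne
      · exact I.zero_mem
    rcases hIprime (f t₀) (act (g s₀) t₀⁻¹) (fun c => by
      have := key (act c t₀)
      rwa [hact_comp, mul_inv_cancel, hact_id] at this) with h | h
    · exact ht₀.2 h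
    · apply hs₀.2
      have := hInv t₀ _ h
      rwa [hact_comp, inv_mul_cancel, hact_id] at this
end

section
/- Assume Ť acts on the K-algebra S by semisimple automorphisms with weight set contained in a free abelian group, meaning: S carries a grading S = ⊕_{h∈H} S_h by a free abelian group H with S_g · S_h ⊆ S_{g+h}, and there is an injective group homomorphism χ from H to the group of characters Hom(Ť, K^×) such that s.t = χ(h)(t)·s for every s ∈ S_h and t ∈ Ť. Then for every prime two-sided ideal J of the skew product Š = S#Ť, the intersection I := J ∩ S (identifying S with S ⊗ 1 inside Š) is a Ť-invariant prime two-sided ideal of S. -/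
/-- An additive family of simultaneous eigenvectors: components of elements of an invariant
subspace lie in the subspace. -/
theorem aux_component_mem {K M T H : Type*} [Field K] [AddCommGroup M] [Module K M] [Group T]
    (χ : H → (T →* Kˣ)) (hχ : Function.Injective χ) (N : Submodule K M)
    (F : Finset H) (s : H → M)
    (hs : ∀ t : T, (∑ h ∈ F, (χ h t : K) • s h) ∈ N) : ∀ h ∈ F, s h ∈ N := by
  intro h hh
  rw [← Submodule.Quotient.mk_eq_zero, ← Module.forall_dual_apply_eq_zero_iff K]
  intro φ
  have hinj : Function.Injective (fun h => (Units.coeHom K).comp (χ h)) := by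
    intro a b hab
    apply hχ
    ext t
    exact DFunLike.congr_fun hab t
  have hli := (linearIndependent_monoidHom T K).comp _ hinj
  rw [linearIndependent_iff'] at hli
  refine hli F (fun h => φ (Submodule.Quotient.mk (s h))) ?_ h hh
  funext t
  have h1 := congrArg φ ((Submodule.Quotient.mk_eq_zero N).mpr (hs t))
  rw [← Submodule.mkQ_apply, map_sum, map_sum] at h1
  simp only [map_smul, map_zero, Submodule.mkQ_apply, smul_eq_mul] at h1
  simp only [Finset.sum_apply, Pi.smul_apply, Function.comp_apply, smul_eq_mul, Pi.zero_apply,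
    MonoidHom.comp_apply, Units.coeHom_apply]
  rw [← h1]
  exact Finset.sum_congr rfl fun _ _ => mul_comm _ _

theorem aux_uniqueSums (H : Type*) [AddCommGroup H] [Module.Free ℤ H] : UniqueSums H :=
  UniqueSums.of_injective_addHom
    (⟨(Module.Free.chooseBasis ℤ H).repr, map_add _⟩ :
      AddHom H (Module.Free.ChooseBasisIndex ℤ H →₀ ℤ))
    (Module.Free.chooseBasis ℤ H).repr.injective inferInstance

/-- Graded-prime implies prime, for a grading by a group with unique sums. -/
theorem aux_graded_prime {K S H : Type*} [Field K] [Ring S] [Algebra K S]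
    [AddCommGroup H] [UniqueSums H] [DecidableEq H]
    (𝒜 : H → Submodule K S) [GradedRing 𝒜] (N : Submodule K S)
    (hl : ∀ r, ∀ a ∈ N, r * a ∈ N) (hr : ∀ r, ∀ a ∈ N, a * r ∈ N)
    (hcomp : ∀ s ∈ N, ∀ h, GradedRing.proj 𝒜 h s ∈ N)
    (hprime : ∀ h g, ∀ a ∈ 𝒜 h, ∀ b ∈ 𝒜 g, (∀ c, a * c * b ∈ N) → a ∈ N ∨ b ∈ N)
    (a b : S) (hab : ∀ c, a * c * b ∈ N) : a ∈ N ∨ b ∈ N := by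
  classical
  have hsum : ∀ x : S, ∑ h ∈ (DirectSum.decompose 𝒜 x).support, GradedRing.proj 𝒜 h x = x :=
    fun x => DirectSum.sum_support_decompose 𝒜 x
  have hmem : ∀ (x : S) h, GradedRing.proj 𝒜 h x ∈ 𝒜 h := fun x h => SetLike.coe_mem _
  have hne : ∀ x : S, x ∉ N → ((DirectSum.decompose 𝒜 x).support.filter
      (fun h => GradedRing.proj 𝒜 h x ∉ N)).Nonempty := by
    intro x hx
    by_contra hcon
    rw [Finset.not_nonempty_iff_eq_empty, Finset.filter_eq_empty_iff] at hcon
    apply hx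
    rw [← hsum x]
    exact Submodule.sum_mem _ fun h hh => not_not.mp (hcon hh)
  by_contra hcon
  push Not at hcon
  obtain ⟨h0, hh0, g0, hg0, huniq⟩ :=
    UniqueSums.uniqueAdd_of_nonempty (hne a hcon.1) (hne b hcon.2)
  rw [Finset.mem_filter] at hh0 hg0
  have key : ∀ c, GradedRing.proj 𝒜 h0 a * c * GradedRing.proj 𝒜 g0 b ∈ N := by
    intro c
    induction c using DirectSum.Decomposition.inductionOn 𝒜 with
    | zero => simp
    | add m m' hm hm' => rw [mul_add, add_mul]; exact N.add_mem hm hm'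
    | @homogeneous d c =>
      have h1 := hcomp _ (hab c) (h0 + d + g0)
      have h2 : a * c * b = ∑ p ∈ (DirectSum.decompose 𝒜 a).support ×ˢ
          (DirectSum.decompose 𝒜 b).support,
          GradedRing.proj 𝒜 p.1 a * c * GradedRing.proj 𝒜 p.2 b := by
        rw [Finset.sum_product]
        simp only [← Finset.mul_sum, ← Finset.sum_mul, hsum]
      rw [h2, map_sum, ← Finset.add_sum_erase _ _
        (Finset.mk_mem_product hh0.1 hg0.1 : (h0, g0) ∈ _)] at h1
      have hm : ∀ p : H × H, GradedRing.proj 𝒜 p.1 a * c * GradedRing.proj 𝒜 p.2 b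
          ∈ 𝒜 (p.1 + d + p.2) := fun p =>
        SetLike.mul_mem_graded (SetLike.mul_mem_graded (hmem _ _) c.2) (hmem _ _)
      have h3 : GradedRing.proj 𝒜 (h0 + d + g0)
          (GradedRing.proj 𝒜 h0 a * c * GradedRing.proj 𝒜 g0 b)
          = GradedRing.proj 𝒜 h0 a * c * GradedRing.proj 𝒜 g0 b :=
        DirectSum.decompose_of_mem_same 𝒜 (hm (h0, g0))
      rw [h3] at h1
      refine (N.add_mem_iff_left (Submodule.sum_mem _ ?_)).mp h1
      intro p hp
      rw [Finset.mem_erase, Finset.mem_product] at hp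
      by_cases hd : p.1 + d + p.2 = h0 + d + g0
      · apply hcomp
        by_contra hnot
        have ha : GradedRing.proj 𝒜 p.1 a ∉ N := fun h => hnot (hr _ _ (hr _ _ h))
        have hb : GradedRing.proj 𝒜 p.2 b ∉ N := fun h => hnot (hl _ _ h)
        have := huniq (Finset.mem_filter.mpr ⟨hp.2.1, ha⟩) (Finset.mem_filter.mpr ⟨hp.2.2, hb⟩)
          (by
            have h5 : (p.1 + p.2) + d = (h0 + g0) + d := by
              rw [add_right_comm, hd, add_right_comm]
            exact add_right_cancel h5)
        exact hp.1 (Prod.ext this.1 this.2)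
      · have : GradedRing.proj 𝒜 (h0 + d + g0)
          (GradedRing.proj 𝒜 p.1 a * c * GradedRing.proj 𝒜 p.2 b) = 0 :=
          DirectSum.decompose_of_mem_ne 𝒜 (hm p) hd
        rw [this]
        exact N.zero_mem
  rcases hprime h0 g0 _ (hmem _ _) _ (hmem _ _) key with h | h
  · exact hh0.2 h
  · exact hg0.2 h


/-- Let `K` be a field, `S` a `K`-algebra, and `T` a group isomorphic
to `ℤ^l` acting on `S` by `K`-algebra automorphisms.  Assume the action is semisimple
with weight set contained in a free abelian group: `S` carries a grading
`𝒜 : H → Submodule K S` by a free abelian group `H` (with `𝒜 g * 𝒜 h ⊆ 𝒜 (g+h)`),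
and there is an injective group homomorphism `χ` from `H` to the character group
`Hom(T, Kˣ)` such that `s.t = χ(h)(t) • s` for every `s ∈ 𝒜 h` and `t ∈ T`.
Let `Sk = S#T` be the skew product (ring embedding `j : S →+* Sk`, units
`u : T →* Skˣ`, relation `(u t) * j s = j (s.t⁻¹) * (u t)`, and `Sk` free as a left
`S`-module on the `u t`).  Then for every prime two-sided ideal `J` of `Sk`,
`I := J ∩ S` (i.e. `j ⁻¹' J`) is a `T`-invariant prime two-sided ideal of `S`. -/
theorem contraction_of_prime_in_skew_product
    {K S T Sk H : Type*} [Field K] [Ring S] [Algebra K S] [Group T] [Ring Sk]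
    [AddCommGroup H] [Module.Free ℤ H] [DecidableEq H]
    (l : ℕ) (e : T ≃* Multiplicative (Fin l → ℤ))
    (act : S → T → S)
    (hact_add : ∀ t s₁ s₂, act (s₁ + s₂) t = act s₁ t + act s₂ t)
    (hact_mul : ∀ t s₁ s₂, act (s₁ * s₂) t = act s₁ t * act s₂ t)
    (hact_one : ∀ t, act 1 t = 1)
    (hact_smul : ∀ t (k : K) s, act (k • s) t = k • act s t)
    (hact_id : ∀ s, act s 1 = s)
    (hact_comp : ∀ s t₁ t₂, act (act s t₁) t₂ = act s (t₁ * t₂))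
    (𝒜 : H → Submodule K S) [GradedRing 𝒜]
    (χ : H → (T →* Kˣ))
    (hχ_add : ∀ h₁ h₂ : H, ∀ t : T, χ (h₁ + h₂) t = χ h₁ t * χ h₂ t)
    (hχ_inj : Function.Injective χ)
    (hweight : ∀ (h : H), ∀ s ∈ 𝒜 h, ∀ t : T, act s t = (χ h t : K) • s)
    (j : S →+* Sk) (u : T →* Skˣ)
    (hcomm : ∀ t s, (u t : Sk) * j s = j (act s t⁻¹) * (u t : Sk))
    (hfree : Function.Bijective fun f : T →₀ S => f.sum fun t s => j s * (u t : Sk))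
    (J : TwoSidedIdeal Sk)
    (hJproper : (J : Set Sk) ≠ Set.univ)
    (hJprime : ∀ a b : Sk, (∀ c : Sk, a * c * b ∈ J) → a ∈ J ∨ b ∈ J) :
    let I : Set S := {s : S | j s ∈ J}
    (∀ t : T, ∀ s ∈ I, act s t ∈ I) ∧
    (∀ a b : S, a ∈ I → b ∈ I → a + b ∈ I) ∧
    (∀ a ∈ I, -a ∈ I) ∧
    (∀ r : S, ∀ a ∈ I, r * a ∈ I ∧ a * r ∈ I) ∧
    I ≠ Set.univ ∧
    (∀ a b : S, (∀ c : S, a * c * b ∈ I) → a ∈ I ∨ b ∈ I) := by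
  classical
  intro I
  have hinv : ∀ t : T, ∀ s ∈ I, act s t ∈ I := by
    intro t s hs
    have h1 := hcomm t⁻¹ s
    rw [inv_inv] at h1
    have h2 : j (act s t) = (u t⁻¹ : Sk) * j s * (u t : Sk) := by
      rw [h1, mul_assoc, ← Units.val_mul, ← map_mul]
      simp
    change j (act s t) ∈ J
    rw [h2]
    exact J.mul_mem_right _ _ (J.mul_mem_left _ _ hs)
  have hadd : ∀ a b : S, a ∈ I → b ∈ I → a + b ∈ I := by
    intro a b ha hb
    change j (a + b) ∈ J
    rw [map_add]
    exact J.add_mem ha hb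
  have hneg : ∀ a ∈ I, -a ∈ I := by
    intro a ha
    change j (-a) ∈ J
    rw [map_neg]
    exact J.neg_mem ha
  have hl : ∀ r : S, ∀ a ∈ I, r * a ∈ I := by
    intro r a ha
    change j (r * a) ∈ J
    rw [map_mul]
    exact J.mul_mem_left _ _ ha
  have hr : ∀ r : S, ∀ a ∈ I, a * r ∈ I := by
    intro r a ha
    change j (a * r) ∈ J
    rw [map_mul]
    exact J.mul_mem_right _ _ ha
  let N : Submodule K S :=
    { carrier := I
      add_mem' := fun {a b} ha hb => hadd a b ha hb
      zero_mem' := by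
        change j 0 ∈ J
        rw [map_zero]
        exact J.zero_mem
      smul_mem' := fun k a ha => by
        rw [Algebra.smul_def]
        exact hl _ _ ha }
  refine ⟨hinv, hadd, hneg, fun r a ha => ⟨hl r a ha, hr r a ha⟩, ?_, ?_⟩
  · intro hI
    apply hJproper
    have h1 : (1 : S) ∈ I := hI ▸ Set.mem_univ _
    have h2 : j 1 ∈ J := h1
    rw [map_one] at h2
    ext x
    simp only [Set.mem_univ, iff_true]
    have := J.mul_mem_left x 1 h2
    rwa [mul_one] at this
  have := aux_uniqueSums H
  refine aux_graded_prime 𝒜 N hl hr ?_ ?_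
  · intro s hs h
    have hsum : ∑ h ∈ (DirectSum.decompose 𝒜 s).support, GradedRing.proj 𝒜 h s = s :=
      DirectSum.sum_support_decompose 𝒜 s
    by_cases hh : h ∈ (DirectSum.decompose 𝒜 s).support
    · refine aux_component_mem χ hχ_inj N (DirectSum.decompose 𝒜 s).support
        (fun h => GradedRing.proj 𝒜 h s) ?_ h hh
      intro t
      have h1 : act s t ∈ N := hinv t s hs
      let A : S →+ S := AddMonoidHom.mk' (fun s => act s t) (hact_add t)
      have h2 : act s t = ∑ h ∈ (DirectSum.decompose 𝒜 s).support,
          (χ h t : K) • GradedRing.proj 𝒜 h s := by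
        change A s = _
        conv_lhs => rw [← hsum]
        rw [map_sum]
        exact Finset.sum_congr rfl fun g _ => hweight g _ (SetLike.coe_mem _) t
      rwa [← h2]
    · have h0 : GradedRing.proj 𝒜 h s = 0 := by
        rw [DFinsupp.notMem_support_iff] at hh
        rw [GradedRing.proj_apply, hh]
        rfl
      rw [h0]
      exact N.zero_mem
  · intro h g a ha b hb hab
    refine hJprime (j a) (j b) ?_
    intro c
    obtain ⟨f, rfl⟩ := hfree.2 c
    simp only [Finsupp.sum]
    rw [Finset.mul_sum, Finset.sum_mul]
    refine sum_mem fun t _ => ?_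
    have h1 : j a * (j (f t) * (u t : Sk)) * j b
        = j ((χ g t⁻¹ : K) • (a * f t * b)) * (u t : Sk) := by
      rw [mul_assoc, mul_assoc, hcomm, hweight g b hb, ← mul_smul_comm, map_mul, map_mul]
      simp only [mul_assoc]
    rw [h1]
    exact J.mul_mem_right _ _ (N.smul_mem _ (hab _))
end

section
/- Let (W, S) be a Coxeter system with W finite and irreducible, i.e., the Coxeter graph on S (with an edge between distinct generators s and t whenever the order of st is at least 3) is connected. If J₁ and J₂ are disjoint subsets of S with J₁ ∪ J₂ = S and both J₁ and J₂ nonempty, then W ≠ W_{J₁} · W_{J₂}: there exists an element w ∈ W that cannot be written as w = w₁w₂ with w₁ ∈ W_{J₁} and w₂ ∈ W_{J₂}. -/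
open Module Polynomial.Chebyshev in
/-- Two reflections whose pairing is governed by `cos (π / m)` satisfy the braid relation. -/
lemma reflection_pow_eq_one_of_cos {V : Type*} [AddCommGroup V] [Module ℝ V] {x y : V}
    {f g : Dual ℝ V} (hf : f x = 2) (hg : g y = 2) (m : ℕ) (hm : 2 ≤ m)
    (hfy : f y = -2 * Real.cos (Real.pi / m)) (hgx : g x = -2 * Real.cos (Real.pi / m)) :
    (reflection hf * reflection hg) ^ m = 1 := by
  rcases hm.eq_or_lt with rfl | hm
  · have h1 : f y = 0 := by rw [hfy]; simp
    have h2 : g x = 0 := by rw [hgx]; simp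
    ext z
    simp only [pow_two, LinearEquiv.mul_apply, reflection_apply, map_sub, map_smul, hf, hg, h1, h2]
    change _ = z
    module
  · have hm0 : (0 : ℝ) < m := by exact_mod_cast (by omega : 0 < m)
    have hm3 : (3 : ℝ) ≤ m := by exact_mod_cast hm
    set θ : ℝ := 2 * (Real.pi / m) with hθ
    have ht : 2 * Real.cos θ = f y * g x - 2 := by
      rw [hfy, hgx, hθ, Real.cos_two_mul]; ring
    have hmθ : m * θ = 2 * Real.pi := by rw [hθ]; field_simp
    have hsin : Real.sin θ ≠ 0 := by
      apply ne_of_gt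
      apply Real.sin_pos_of_pos_of_lt_pi
      · have := Real.pi_pos; positivity
      · have := Real.pi_pos
        have h0 : 0 < θ := by positivity
        nlinarith
    ext z
    rw [reflection_mul_reflection_pow_apply hf hg m z (2 * Real.cos θ) ht]
    have hS := fun n : ℤ => S_two_mul_real_cos (θ := θ) (n := n)
    rcases Nat.even_or_odd' m with ⟨k, hk | hk⟩
    · have e1 : ((m : ℤ) - 2) / 2 = (k : ℤ) - 1 := by omega
      have e2 : ((m : ℤ) - 1) / 2 = (k : ℤ) - 1 := by omega
      have hz : (S ℝ ((k : ℤ) - 1)).eval (2 * Real.cos θ) = 0 := by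
        have h := hS ((k : ℤ) - 1)
        have : (((k : ℤ) - 1 : ℤ) + 1 : ℝ) * θ = Real.pi := by
          rw [hk] at hmθ; push_cast at hmθ ⊢; linarith
        rw [this, Real.sin_pi] at h
        exact (mul_eq_zero.mp h).resolve_right hsin
      rw [e1, e2, hz]
      simp
    · have e1 : ((m : ℤ) - 2) / 2 = (k : ℤ) - 1 := by omega
      have e2 : ((m : ℤ) - 1) / 2 = (k : ℤ) := by omega
      have e3 : ((m : ℤ) - 3) / 2 = (k : ℤ) - 1 := by omega
      have e4 : (m : ℤ) / 2 = (k : ℤ) := by omega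
      have hz : (S ℝ (k : ℤ)).eval (2 * Real.cos θ)
          + (S ℝ ((k : ℤ) - 1)).eval (2 * Real.cos θ) = 0 := by
        have h := hS ((k : ℤ) - 1)
        have h' := hS (k : ℤ)
        have e : (((k : ℤ) : ℝ) + 1) * θ
            = 2 * Real.pi - (((k : ℤ) - 1 : ℤ) + 1 : ℝ) * θ := by
          rw [hk] at hmθ; push_cast at hmθ ⊢; linarith
        rw [e, Real.sin_two_pi_sub, ← h] at h'
        have : ((S ℝ (k : ℤ)).eval (2 * Real.cos θ)
          + (S ℝ ((k : ℤ) - 1)).eval (2 * Real.cos θ)) * Real.sin θ = 0 := by linarith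
        exact (mul_eq_zero.mp this).resolve_right hsin
      rw [e1, e2, e3, e4, hz]
      simp

namespace CoxGeom

variable {B : Type*} (M : CoxeterMatrix B)

/-- The matrix of (twice) the canonical bilinear form. -/
noncomputable def K (i j : B) : ℝ := -2 * Real.cos (Real.pi / M i j)

lemma K_diag (i : B) : K M i i = 2 := by simp [K]

lemma K_symm (i j : B) : K M i j = K M j i := by simp [K, M.symmetric i j]

/-- The simple coroot. -/
noncomputable def coroot (i : B) : Module.Dual ℝ (B →₀ ℝ) := Finsupp.linearCombination ℝ (K M i)

/-- The simple root. -/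
noncomputable def root (i : B) : B →₀ ℝ := Finsupp.single i 1

lemma coroot_root (i j : B) : coroot M i (root j) = K M i j := by
  simp [coroot, root]

lemma coroot_self (i : B) : coroot M i (root i) = 2 := by rw [coroot_root, K_diag]

/-- The canonical bilinear form. -/
noncomputable def form : (B →₀ ℝ) →ₗ[ℝ] Module.Dual ℝ (B →₀ ℝ) :=
  Finsupp.linearCombination ℝ (coroot M)

lemma form_root_left (i : B) (v : B →₀ ℝ) : form M (root i) v = coroot M i v := by
  simp [form, root]

lemma form_root_right (i : B) (v : B →₀ ℝ) : form M v (root i) = coroot M i v := by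
  induction v using Finsupp.induction_linear with
  | zero => simp
  | add a b ha hb => simp [ha, hb]
  | single j r => simp [form, coroot, root, K_symm M i j]

/-- The simple reflection in the geometric representation. -/
noncomputable def refl (i : B) : (B →₀ ℝ) ≃ₗ[ℝ] (B →₀ ℝ) := Module.reflection (coroot_self M i)

lemma refl_apply (i : B) (v : B →₀ ℝ) : refl M i v = v - coroot M i v • root i :=
  Module.reflection_apply _ _

lemma form_refl (i : B) (v w : B →₀ ℝ) : form M (refl M i v) (refl M i w) = form M v w := by
  simp only [refl_apply, map_sub, map_smul, LinearMap.sub_apply, LinearMap.smul_apply,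
    form_root_left, form_root_right, coroot_self, smul_eq_mul]
  ring

lemma liftable : M.IsLiftable (refl M) := by
  intro i j
  by_cases hij : i = j
  · subst hij
    have : refl M i * refl M i = 1 := by
      ext v : 1
      exact Module.involutive_reflection (coroot_self M i) v
    rw [this, one_pow]
  · have h1 := M.off_diagonal i j hij
    by_cases h0 : M i j = 0
    · rw [h0, pow_zero]
    · refine reflection_pow_eq_one_of_cos _ _ _ (by omega) ?_ ?_
      · rw [coroot_root, K]
      · rw [coroot_root, K_symm, K]

variable {M} {W : Type*} [Group W] (cs : CoxeterSystem M W)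

/-- The geometric representation. -/
noncomputable def rep : W →* ((B →₀ ℝ) ≃ₗ[ℝ] (B →₀ ℝ)) := cs.lift ⟨refl M, liftable M⟩

lemma rep_simple (i : B) : rep cs (cs.simple i) = refl M i := cs.lift_apply_simple _ _

lemma form_rep (w : W) (u v : B →₀ ℝ) : form M (rep cs w u) (rep cs w v) = form M u v := by
  induction w using cs.simple_induction generalizing u v with
  | simple i => rw [rep_simple, form_refl]
  | one => simp
  | mul a b ha hb => rw [map_mul, LinearEquiv.mul_apply, LinearEquiv.mul_apply, ha, hb]

lemma rep_coord {J : Set B} {w : W} (hw : w ∈ Subgroup.closure (cs.simple '' J))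
    {b : B} (hb : b ∉ J) (v : B →₀ ℝ) : rep cs w v b = v b := by
  induction hw using Subgroup.closure_induction generalizing v with
  | mem x hx =>
    obtain ⟨i, hi, rfl⟩ := hx
    have : i ≠ b := fun h => hb (h ▸ hi)
    simp [rep_simple, refl_apply, root, this]
  | one => simp
  | mul x y _ _ hx hy => rw [map_mul, LinearEquiv.mul_apply, hx, hy]
  | inv x _ hx =>
    rw [← hx, ← LinearEquiv.mul_apply, ← map_mul]
    simp

end CoxGeom


/-- Let `(W, S)` be a Coxeter system with `W` finite and irreducible,
i.e. the Coxeter graph on the index set `B` (with an edge between distinct `i, j`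
whenever `M i j ≥ 3`) is connected.  If `J₁, J₂` are disjoint subsets of `B` with
`J₁ ∪ J₂ = B`, both nonempty, then `W ≠ W_{J₁} · W_{J₂}`: there is `w ∈ W` that cannot
be written as `w = w₁ * w₂` with `w₁` in the parabolic subgroup generated by the simple
reflections indexed by `J₁` and `w₂` in the one indexed by `J₂`. -/
theorem irreducible_coxeter_not_product_of_parabolics
    {B W : Type*} [Group W] [Finite W]
    (M : CoxeterMatrix B) (cs : CoxeterSystem M W)
    (G : SimpleGraph B)
    (hG : ∀ i j : B, G.Adj i j ↔ i ≠ j ∧ 3 ≤ M i j)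
    (hconn : G.Connected)
    (J₁ J₂ : Set B) (hdisj : Disjoint J₁ J₂) (hunion : J₁ ∪ J₂ = Set.univ)
    (h₁ : J₁.Nonempty) (h₂ : J₂.Nonempty) :
    ∃ w : W, ∀ w₁ ∈ Subgroup.closure (cs.simple '' J₁),
      ∀ w₂ ∈ Subgroup.closure (cs.simple '' J₂), w ≠ w₁ * w₂ := by

  classical
  have hcompl : ∀ b, b ∉ J₁ → b ∈ J₂ := fun b hb =>
    (by rw [hunion]; trivial : b ∈ J₁ ∪ J₂).resolve_left hb
  have hnot : ∀ b, b ∈ J₁ → b ∉ J₂ := fun b hb => Set.disjoint_left.mp hdisj hb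
  obtain ⟨a, ha⟩ := h₁
  obtain ⟨b, hb⟩ := h₂
  obtain ⟨p⟩ := hconn.preconnected a b
  obtain ⟨d, -, hd1, hd2⟩ := p.exists_boundary_dart J₁ ha (fun h => hnot b h hb)
  obtain ⟨hij, h3⟩ := (hG _ _).mp d.adj
  generalize d.fst = i at *
  generalize d.snd = j at *
  refine ⟨cs.simple j * cs.simple i, fun w₁ hw₁ w₂ hw₂ h => ?_⟩
  have hK : CoxGeom.K M i j ≠ 0 := by
    have h3' : (3 : ℝ) ≤ M i j := by exact_mod_cast h3
    have hpi := Real.pi_pos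
    have : 0 < Real.cos (Real.pi / M i j) := by
      apply Real.cos_pos_of_mem_Ioo
      constructor
      · have : 0 < Real.pi / M i j := by positivity
        linarith
      · exact div_lt_div_of_pos_left hpi (by norm_num) (by linarith)
    unfold CoxGeom.K
    have := this.ne'
    simp [this]
  have h' : w₁⁻¹ * cs.simple j = w₂ * cs.simple i := by
    rw [inv_mul_eq_iff_eq_mul, ← mul_assoc, ← h, cs.simple_mul_simple_cancel_right]
  have hu1 := congrArg (fun w => CoxGeom.rep cs w (CoxGeom.root i)) h'
  simp only [map_mul, LinearEquiv.mul_apply, CoxGeom.rep_simple] at hu1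
  have hu : CoxGeom.rep cs (w₂ * cs.simple i) (CoxGeom.root i)
      = -CoxGeom.root i - CoxGeom.K M i j • CoxGeom.root j := by
    ext b
    rw [map_mul, LinearEquiv.mul_apply, CoxGeom.rep_simple]
    by_cases hb : b ∈ J₁
    · rw [CoxGeom.rep_coord cs hw₂ (hnot b hb)]
      have hjb : j ≠ b := fun h => hd2 (h ▸ hb)
      rw [CoxGeom.refl_apply, CoxGeom.coroot_self]
      simp only [CoxGeom.root, Finsupp.sub_apply, Finsupp.smul_apply, Finsupp.neg_apply,
        Finsupp.single_eq_of_ne hjb.symm, smul_eq_mul]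
      ring
    · rw [← hu1, CoxGeom.rep_coord cs (inv_mem hw₁) hb]
      have hib : i ≠ b := fun h => hb (h ▸ hd1)
      simp [CoxGeom.refl_apply, CoxGeom.coroot_root, CoxGeom.K_symm M j i]
      simp [CoxGeom.root, hib]
  have hform := CoxGeom.form_rep cs (w₂ * cs.simple i) (CoxGeom.root i) (CoxGeom.root i)
  rw [hu] at hform
  simp only [map_sub, map_neg, map_smul, LinearMap.sub_apply, LinearMap.neg_apply,
    LinearMap.smul_apply, CoxGeom.form_root_left, CoxGeom.coroot_root, CoxGeom.K_diag,
    CoxGeom.K_symm M j i, smul_eq_mul] at hform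
  have : 0 < CoxGeom.K M i j ^ 2 := by positivity
  nlinarith
end
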